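/- Let f : ℝ → ℝ be Lebesgue integrable on every compact interval such that the improper integral F(x) := ∫_{-∞}^x f exists for every x ∈ ℝ and the improper integral ∫_{-∞}^∞ f exists. Let y ∈ ℝ be such that f̂(y) = ∫_{-∞}^∞ f(t)e^{−2πiyt} dt exists as an improper integral and the function F_y(x) := ∫_{-∞}^x f(t)e^{−2πiyt} dt (improper integral) is Lebesgue integrable on ℝ. Let g : ℝ → ℝ be Lebesgue integrable on ℝ and of bounded variation on ℝ, set G(x) := ∫_{-∞}^x g, and assume G is Lebesgue integrable on ℝ with lim_{x→∞} G(x) = 0. Then the Fourier transform at y of f*G (where (f*G)(x) := improper ∫_{-∞}^∞ f(x−u)G(u) du) exists and (f*G)^(y) = f̂(y)·Ĝ(y), where Ĝ(y) = ∫_{-∞}^∞ G(x)e^{−2πixy} dx (a Lebesgue integral since G ∈ L¹(ℝ)). -/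

import Mathlib

open MeasureTheory Filter Topology intervalIntegral

/-- The improper integral `∫_{-∞}^∞ h = L` (real-valued). -/
def HasImpInt (h : ℝ → ℝ) (L : ℝ) : Prop :=
  ∃ L₁ L₂ : ℝ,
    Tendsto (fun c => ∫ x in c..(0:ℝ), h x) atBot (𝓝 L₁) ∧
    Tendsto (fun c => ∫ x in (0:ℝ)..c, h x) atTop (𝓝 L₂) ∧ L = L₁ + L₂

/-- The improper integral `∫_{-∞}^∞ h = z` (complex-valued). -/
def HasImpIntC (h : ℝ → ℂ) (z : ℂ) : Prop :=
  ∃ z₁ z₂ : ℂ,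
    Tendsto (fun c => ∫ x in c..(0:ℝ), h x) atBot (𝓝 z₁) ∧
    Tendsto (fun c => ∫ x in (0:ℝ)..c, h x) atTop (𝓝 z₂) ∧ z = z₁ + z₂

/-- The Fourier kernel `e^{-2πixy}`. -/
noncomputable def fourierKernel (x y : ℝ) : ℂ :=
  Complex.exp (-(2 * Real.pi * Complex.I * x * y))

section Primitives

variable {𝕜 : Type*} [RCLike 𝕜] {p q P Q : ℝ → 𝕜}

/-- Integration by parts for primitives of locally integrable functions. -/
lemma integral_mul_primitive_eq_sub
    (hp : ∀ a b, IntervalIntegrable p volume a b) (hq : ∀ a b, IntervalIntegrable q volume a b)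
    (hP : ∀ a b, P b - P a = ∫ t in a..b, p t) (hQ : ∀ a b, Q b - Q a = ∫ t in a..b, q t)
    (hPc : Continuous P) (hQc : Continuous Q) (a b : ℝ) :
    ∫ u in a..b, p u * Q u = P b * Q b - P a * Q a - ∫ v in a..b, P v * q v := by
  wlog hab : a ≤ b generalizing a b
  · rw [integral_symm, this b a (le_of_not_ge hab), integral_symm b a]
    ring
  have key : ∫ u in a..b, p u * (Q u - Q a) = ∫ v in a..b, (P b - P v) * q v := by
    have hswap : ∫ u in Set.Ioc a b, ∫ v in Set.Ioc a b, (Set.Iic u).indicator (fun v => p u * q v) v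
        = ∫ v in Set.Ioc a b, ∫ u in Set.Ioc a b, (Set.Iic u).indicator (fun v => p u * q v) v := by
      apply integral_integral_swap
      have h := (hp a b).1.integrable.mul_prod (hq a b).1.integrable
      refine (h.indicator (s := {z : ℝ × ℝ | z.2 ≤ z.1})
        (measurableSet_le measurable_snd measurable_fst)).congr (Eventually.of_forall fun z => ?_)
      simp [Set.indicator, Function.uncurry]
    rw [integral_of_le hab, integral_of_le hab]
    refine Eq.trans (setIntegral_congr_fun measurableSet_Ioc fun u hu => ?_)
      (hswap.trans (setIntegral_congr_fun measurableSet_Ioc fun v hv => ?_))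
    · rw [setIntegral_indicator measurableSet_Iic, Set.Ioc_inter_Iic, min_eq_right hu.2,
        MeasureTheory.integral_const_mul, hQ, integral_of_le hu.1.le]
    · have : ∀ u, (Set.Iic u).indicator (fun v => p u * q v) v
          = (Set.Ici v).indicator (fun u => p u * q v) u := by
        intro u
        simp [Set.indicator]
      simp_rw [this]
      rw [setIntegral_indicator measurableSet_Ici, MeasureTheory.integral_mul_const, hP,
        integral_of_le hv.2, ← integral_Icc_eq_integral_Ioc]
      congr 3
      ext u
      simp only [Set.mem_inter_iff, Set.mem_Ioc, Set.mem_Ici, Set.mem_Icc]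
      exact ⟨fun h => ⟨h.2, h.1.2⟩, fun h => ⟨⟨hv.1.trans_le h.1, h.2⟩, h.1⟩⟩
  have h1 : ∫ u in a..b, p u * (Q u - Q a) = (∫ u in a..b, p u * Q u) - (P b - P a) * Q a := by
    simp_rw [mul_sub]
    rw [intervalIntegral.integral_sub ((hp a b).mul_continuousOn hQc.continuousOn)
      ((hp a b).mul_const _), intervalIntegral.integral_mul_const, hP]
  have h2 : ∫ v in a..b, (P b - P v) * q v = P b * (Q b - Q a) - ∫ v in a..b, P v * q v := by
    simp_rw [sub_mul]
    rw [intervalIntegral.integral_sub ((hq a b).const_mul _)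
      ((hq a b).continuousOn_mul hPc.continuousOn), intervalIntegral.integral_const_mul, hQ]
  rw [h1, h2] at key
  linear_combination key

lemma continuous_of_sub_eq_integral (hp : ∀ a b, IntervalIntegrable p volume a b)
    (hP : ∀ a b, P b - P a = ∫ t in a..b, p t) : Continuous P := by
  have : P = fun b => P 0 + ∫ t in (0 : ℝ)..b, p t := by
    funext b
    rw [← hP]
    ring
  rw [this]
  exact continuous_const.add (continuous_primitive hp 0)

lemma exists_norm_le_of_tendsto_atBot_atTop {E : Type*} [NormedAddCommGroup E] {P : ℝ → E}
    (hPc : Continuous P) {l m : E}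
    (hbot : Tendsto P atBot (𝓝 l)) (htop : Tendsto P atTop (𝓝 m)) : ∃ C, ∀ x, ‖P x‖ ≤ C := by
  obtain ⟨A, hA⟩ := eventually_atBot.1 (hbot.norm.eventually_le_const (lt_add_one ‖l‖))
  obtain ⟨B, hB⟩ := eventually_atTop.1 (htop.norm.eventually_le_const (lt_add_one ‖m‖))
  obtain ⟨C, hC⟩ := (isCompact_Icc (a := A) (b := B)).exists_bound_of_continuousOn
    hPc.continuousOn
  refine ⟨max (max (‖l‖ + 1) (‖m‖ + 1)) C, fun x => ?_⟩
  rcases le_total x A with h | h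
  · exact (hA x h).trans (by simp)
  rcases le_total B x with h' | h'
  · exact (hB x h').trans (by simp)
  · exact (hC x ⟨h, h'⟩).trans (by simp)

lemma sub_eq_integral_of_tendsto_atBot (hp : ∀ a b, IntervalIntegrable p volume a b)
    (hP : ∀ x, Tendsto (fun c => ∫ t in c..x, p t) atBot (𝓝 (P x))) (a b : ℝ) :
    P b - P a = ∫ t in a..b, p t := by
  refine tendsto_nhds_unique ((hP b).sub (hP a)) (tendsto_const_nhds.congr fun c => ?_)
  rw [integral_interval_sub_left (hp _ _) (hp _ _)]

lemma tendsto_atBot_zero_of_tendsto_integral (hp : ∀ a b, IntervalIntegrable p volume a b)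
    (hP : ∀ x, Tendsto (fun c => ∫ t in c..x, p t) atBot (𝓝 (P x))) :
    Tendsto P atBot (𝓝 0) := by
  have h := (hP 0).const_sub (P 0)
  rw [sub_self] at h
  refine h.congr fun c => ?_
  rw [← sub_eq_integral_of_tendsto_atBot hp hP]
  ring

lemma tendsto_atTop_of_sub_eq_integral (hP : ∀ a b, P b - P a = ∫ t in a..b, p t) {L : 𝕜}
    (hL : Tendsto (fun c => ∫ t in (0 : ℝ)..c, p t) atTop (𝓝 L)) :
    Tendsto P atTop (𝓝 (P 0 + L)) :=
  (hL.const_add (P 0)).congr fun c => by rw [← hP]; ring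

/-- The improper convolution integral of `p` with a primitive `Q` of `q` vanishing at `±∞` is the
Lebesgue convolution integral of a bounded primitive `P` of `p` with `q`. -/
lemma exists_tendsto_integral_comp_sub_mul (hp : ∀ a b, IntervalIntegrable p volume a b)
    (hq : Integrable q) (hP : ∀ a b, P b - P a = ∫ t in a..b, p t)
    (hQ : ∀ a b, Q b - Q a = ∫ t in a..b, q t) {l m : 𝕜} (hPbot : Tendsto P atBot (𝓝 l))
    (hPtop : Tendsto P atTop (𝓝 m)) (hQbot : Tendsto Q atBot (𝓝 0))
    (hQtop : Tendsto Q atTop (𝓝 0)) (x : ℝ) :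
    ∃ L₁ L₂ : 𝕜, Tendsto (fun c => ∫ u in c..(0 : ℝ), p (x - u) * Q u) atBot (𝓝 L₁) ∧
      Tendsto (fun c => ∫ u in (0 : ℝ)..c, p (x - u) * Q u) atTop (𝓝 L₂) ∧
      ∫ u, P (x - u) * q u = L₁ + L₂ := by
  have hqi : ∀ a b, IntervalIntegrable q volume a b := fun a b => hq.intervalIntegrable
  have hPc := continuous_of_sub_eq_integral hp hP
  have hQc := continuous_of_sub_eq_integral hqi hQ
  obtain ⟨C, hC⟩ := exists_norm_le_of_tendsto_atBot_atTop hPc hPbot hPtop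
  have hint : Integrable fun u => P (x - u) * q u :=
    hq.bdd_mul (c := C) (by fun_prop) (Eventually.of_forall fun u => hC _)
  have hparts : ∀ a b, ∫ u in a..b, p (x - u) * Q u
      = P (x - a) * Q a - P (x - b) * Q b + ∫ u in a..b, P (x - u) * q u := by
    intro a b
    have h := integral_mul_primitive_eq_sub (p := fun u => p (x - u)) (P := fun u => -P (x - u))
      (Q := Q) (q := q) (fun a b => by simpa using (hp (x - a) (x - b)).comp_sub_left x) hqi
      (fun a b => by
        rw [intervalIntegral.integral_comp_sub_left p x, ← hP]
        ring) hQ (by fun_prop) hQc a b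
    rw [h]
    simp_rw [neg_mul, intervalIntegral.integral_neg]
    ring
  have hbdd : ∀ {f : Filter ℝ}, Tendsto Q f (𝓝 0) →
      Tendsto (fun c => P (x - c) * Q c) f (𝓝 0) := fun h =>
    isBoundedUnder_le_mul_tendsto_zero (isBoundedUnder_of ⟨C, fun c => hC (x - c)⟩) h
  refine ⟨-(P x * Q 0) + ∫ u in Set.Iic 0, P (x - u) * q u,
    P x * Q 0 + ∫ u in Set.Ioi 0, P (x - u) * q u, ?_, ?_, ?_⟩
  · have h := ((hbdd hQbot).sub_const (P x * Q 0)).add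
      (intervalIntegral_tendsto_integral_Iic 0 hint.integrableOn tendsto_id)
    simpa [hparts] using h
  · have h := ((hbdd hQtop).const_sub (P x * Q 0)).add
      (intervalIntegral_tendsto_integral_Ioi 0 hint.integrableOn tendsto_id)
    simpa [hparts] using h
  · rw [← intervalIntegral.integral_Iic_add_Ioi (b := (0 : ℝ)) hint.integrableOn hint.integrableOn]
    ring

end Primitives

lemma eq_zero_of_integrable_of_tendsto_atTop {E : Type*} [NormedAddCommGroup E] {P : ℝ → E}
    {z : E} (hP : Integrable P) (h : Tendsto P atTop (𝓝 z)) : z = 0 := by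
  by_contra hz
  have hz' : 0 < ‖z‖ := norm_pos_iff.2 hz
  obtain ⟨A, hA⟩ := eventually_atTop.1 (h.norm.eventually_const_le (half_lt_self hz'))
  have hsub : Set.Ioi A ⊆ {x | ‖z‖ / 2 ≤ ‖P x‖} := fun x hx => hA x (le_of_lt hx)
  have := (measure_mono hsub).trans_lt (hP.measure_norm_ge_lt_top (half_pos hz'))
  simp at this

section Kernel

variable (x u y : ℝ)

lemma fourierKernel_sub_mul : fourierKernel (x - u) y * fourierKernel u y = fourierKernel x y := by
  rw [fourierKernel, fourierKernel, fourierKernel, ← Complex.exp_add]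
  push_cast
  ring_nf

lemma hasDerivAt_fourierKernel : HasDerivAt (fun x => fourierKernel x y)
    (-(2 * Real.pi * Complex.I * y) * fourierKernel x y) x := by
  have h : HasDerivAt (fun x : ℝ => -(2 * Real.pi * Complex.I * x * y))
      (-(2 * Real.pi * Complex.I * 1 * y)) x :=
    (((hasDerivAt_id x).ofReal_comp.const_mul _).mul_const _).neg
  refine h.cexp.congr_deriv ?_
  simp only [fourierKernel]
  ring

lemma continuous_fourierKernel : Continuous fun x => fourierKernel x y :=
  continuous_iff_continuousAt.2 fun x => (hasDerivAt_fourierKernel x y).continuousAt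

lemma norm_fourierKernel : ‖fourierKernel x y‖ = 1 := by
  rw [fourierKernel, show -(2 * Real.pi * Complex.I * x * y)
    = ((-(2 * Real.pi * x * y) : ℝ) : ℂ) * Complex.I by push_cast; ring,
    Complex.norm_exp_ofReal_mul_I]

variable {y} in
lemma MeasureTheory.Integrable.mul_fourierKernel {f : ℝ → ℝ} (hf : Integrable f) :
    Integrable fun x => (f x : ℂ) * fourierKernel x y :=
  hf.ofReal.mul_bdd (c := 1) (continuous_fourierKernel y).aestronglyMeasurable
    (Eventually.of_forall fun x => (norm_fourierKernel x y).le)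

variable {y} in
lemma tendsto_mul_fourierKernel_zero {f : ℝ → ℝ} {l : Filter ℝ} (hf : Tendsto f l (𝓝 0)) :
    Tendsto (fun x => (f x : ℂ) * fourierKernel x y) l (𝓝 0) := by
  rw [tendsto_zero_iff_norm_tendsto_zero] at hf ⊢
  simpa [norm_fourierKernel] using hf

end Kernel

/-- A real interval integrable function stays so as a complex function. -/
lemma IntervalIntegrable.complex_ofReal {f : ℝ → ℝ} {a b : ℝ}
    (hf : IntervalIntegrable f volume a b) :
    IntervalIntegrable (fun t => (f t : ℂ)) volume a b :=
  ⟨hf.1.ofReal, hf.2.ofReal⟩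

/-- A primitive times the Fourier kernel is a primitive, by the product rule. -/
lemma mul_fourierKernel_sub_eq_integral {g G : ℝ → ℝ} (y : ℝ)
    (hg : ∀ a b, IntervalIntegrable g volume a b)
    (hG : ∀ a b, G b - G a = ∫ t in a..b, g t) (a b : ℝ) :
    (G b : ℂ) * fourierKernel b y - G a * fourierKernel a y
      = ∫ t in a..b, ((g t : ℂ) * fourierKernel t y
          + -(2 * Real.pi * Complex.I * y) * (G t * fourierKernel t y)) := by
  have hGc := continuous_of_sub_eq_integral hg hG
  have hEc := continuous_fourierKernel y
  have hg' : ∀ a b, IntervalIntegrable (fun t => (g t : ℂ)) volume a b :=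
    fun a b => (hg a b).complex_ofReal
  have h := integral_mul_primitive_eq_sub (p := fun t => (g t : ℂ)) (P := fun t => (G t : ℂ))
    (q := fun t => -(2 * Real.pi * Complex.I * y) * fourierKernel t y)
    (Q := fun t => fourierKernel t y) hg'
    (fun a b => (hEc.const_mul _).intervalIntegrable a b)
    (fun a b => by rw [intervalIntegral.integral_ofReal, ← hG]; push_cast; ring)
    (fun a b => (integral_eq_sub_of_hasDerivAt (fun t _ => hasDerivAt_fourierKernel t y)
      ((hEc.const_mul _).intervalIntegrable a b)).symm) (by fun_prop) hEc a b
  rw [intervalIntegral.integral_add ((hg' a b).mul_continuousOn hEc.continuousOn)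
    (Continuous.intervalIntegrable (by fun_prop) a b), h]
  simp_rw [mul_left_comm]
  ring

/-- **Fourier transform of a convolution.** Under the stated hypotheses, the Fourier
transform of `f*G` at `y` exists as an improper integral and equals `f̂(y)·Ĝ(y)`. -/
theorem fourier_transform_of_convolution (f g F G : ℝ → ℝ) (y : ℝ) (zf : ℂ) (Fy : ℝ → ℂ)
    (hfloc : ∀ c d : ℝ, IntervalIntegrable f volume c d)
    (hF : ∀ x : ℝ, Tendsto (fun c => ∫ t in c..x, f t) atBot (𝓝 (F x)))
    (hfimp : ∃ L : ℝ, Tendsto (fun c => ∫ t in (0:ℝ)..c, f t) atTop (𝓝 L))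
    (hzf : HasImpIntC (fun t => (f t : ℂ) * fourierKernel t y) zf)
    (hFy : ∀ x : ℝ, Tendsto (fun c => ∫ t in c..x, (f t : ℂ) * fourierKernel t y)
      atBot (𝓝 (Fy x)))
    (hFyint : Integrable Fy)
    (hg : Integrable g) (hgBV : BoundedVariationOn g Set.univ)
    (hG : ∀ x : ℝ, G x = ∫ t in Set.Iic x, g t)
    (hGint : Integrable G) (hG0 : Tendsto G atTop (𝓝 0)) :
    ∃ h : ℝ → ℝ,
      (∀ x : ℝ, HasImpInt (fun u => f (x - u) * G u) (h x)) ∧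
      HasImpIntC (fun x => (h x : ℂ) * fourierKernel x y)
        (zf * ∫ x : ℝ, (G x : ℂ) * fourierKernel x y) := by
  obtain ⟨L, hL⟩ := hfimp
  obtain ⟨z₁, z₂, hz₁, hz₂, rfl⟩ := hzf
  have hgi : ∀ a b, IntervalIntegrable g volume a b := fun a b => hg.intervalIntegrable
  have hEc := continuous_fourierKernel y
  have hfE : ∀ a b, IntervalIntegrable (fun t => (f t : ℂ) * fourierKernel t y) volume a b :=
    fun a b => IntervalIntegrable.mul_continuousOn (hfloc a b).complex_ofReal hEc.continuousOn
  have hFsub := sub_eq_integral_of_tendsto_atBot hfloc hF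
  have hFysub := sub_eq_integral_of_tendsto_atBot hfE hFy
  have hGsub : ∀ a b, G b - G a = ∫ t in a..b, g t := fun a b => by
    rw [hG, hG, integral_Iic_sub_Iic hg.integrableOn hg.integrableOn]
  have hGbot : Tendsto G atBot (𝓝 0) := by
    rw [funext hG]
    exact tendsto_integral_Iic_zero tendsto_id
  have hFytop : Tendsto Fy atTop (𝓝 (z₁ + z₂)) := by
    rw [tendsto_nhds_unique hz₁ (hFy 0)]
    exact tendsto_atTop_of_sub_eq_integral hFysub hz₂
  have hFybot := tendsto_atBot_zero_of_tendsto_integral hfE hFy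
  set g₁ : ℝ → ℂ := fun t => (g t : ℂ) * fourierKernel t y
    + -(2 * Real.pi * Complex.I * y) * (G t * fourierKernel t y) with hg₁
  have hg₁int : Integrable g₁ := hg.mul_fourierKernel.add (hGint.mul_fourierKernel.const_mul _)
  have hGEsub := mul_fourierKernel_sub_eq_integral y hgi hGsub
  have hGEbot := tendsto_mul_fourierKernel_zero (y := y) hGbot
  have hGEtop := tendsto_mul_fourierKernel_zero (y := y) hG0
  have hg₁zero : ∫ t, g₁ t = 0 := by
    refine tendsto_nhds_unique
      (intervalIntegral_tendsto_integral hg₁int tendsto_neg_atTop_atBot tendsto_id) ?_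
    simp_rw [hg₁, ← hGEsub]
    simpa using hGEtop.sub (hGEbot.comp tendsto_neg_atTop_atBot)
  have hreal := exists_tendsto_integral_comp_sub_mul hfloc hg hFsub hGsub
    (tendsto_atBot_zero_of_tendsto_integral hfloc hF) (tendsto_atTop_of_sub_eq_integral hFsub hL)
    hGbot hG0
  have hcomplex := exists_tendsto_integral_comp_sub_mul hfE hg₁int hFysub hGEsub hFybot hFytop
    hGEbot hGEtop
  -- Multiplying the convolution by the kernel gives the convolution of the twisted functions.
  have htwist : ∀ x, ((∫ u, F (x - u) * g u : ℝ) : ℂ) * fourierKernel x y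
      = convolution g₁ Fy (ContinuousLinearMap.mul ℝ ℂ) volume x := by
    intro x
    obtain ⟨L₁, L₂, h₁, h₂, h⟩ := hreal x
    obtain ⟨M₁, M₂, k₁, k₂, k⟩ := hcomplex x
    have hmul : ∀ a b, ∫ u in a..b, (f (x - u) : ℂ) * fourierKernel (x - u) y
        * (G u * fourierKernel u y)
        = ((∫ u in a..b, f (x - u) * G u : ℝ) : ℂ) * fourierKernel x y := by
      intro a b
      rw [← intervalIntegral.integral_ofReal, ← intervalIntegral.integral_mul_const]
      refine intervalIntegral.integral_congr fun u _ => ?_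
      rw [← fourierKernel_sub_mul x u y]
      push_cast
      ring
    simp_rw [hmul] at k₁ k₂
    have e₁ := tendsto_nhds_unique k₁ (((Complex.continuous_ofReal.tendsto _).comp h₁).mul_const _)
    have e₂ := tendsto_nhds_unique k₂ (((Complex.continuous_ofReal.tendsto _).comp h₂).mul_const _)
    simp_rw [convolution, ContinuousLinearMap.mul_apply', mul_comm (g₁ _)]
    rw [k, h, e₁, e₂]
    push_cast
    ring
  have hconv := hg₁int.integrable_convolution (ContinuousLinearMap.mul ℝ ℂ) hFyint
  refine ⟨fun x => ∫ u, F (x - u) * g u, hreal, ?_⟩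
  simp_rw [htwist]
  refine ⟨_, _, intervalIntegral_tendsto_integral_Iic 0 hconv.integrableOn tendsto_id,
    intervalIntegral_tendsto_integral_Ioi 0 hconv.integrableOn tendsto_id, ?_⟩
  rw [intervalIntegral.integral_Iic_add_Ioi hconv.integrableOn hconv.integrableOn,
    integral_convolution _ hg₁int hFyint, hg₁zero,
    eq_zero_of_integrable_of_tendsto_atTop hFyint hFytop]
  simp
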